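/- arXiv:1409.0711 — 2 statements merged into one kernel-verified Lean document; each statement's English description precedes it below -/
import Mathlib

section
/- Let G = (V,E) be a connected simple graph on N ≥ 2 vertices, Ψ a potential on V and β > 0, and let ρ* be the Gibbs distribution. Let γ₀ > 0 be the modified logarithmic Sobolev constant of G with respect to ρ*. If ρ(t) : [0,∞) → M is a solution of Fokker–Planck equation II with initial value ρ⁰ ∈ M, then for all t ≥ 0: H(ρ(t)|ρ*) ≤ H(ρ⁰|ρ*) e^{−ct}, where c = β γ₀ · (min_i ρ*_i)/(max_i ρ*_i). -/
/-!
STATEMENT 2: Exponential decay of relative entropy for Fokker–Planck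
equation II, with rate governed by the modified log-Sobolev constant.
-/

open Finset Real

/-- `ρ` is a positive probability distribution on the `N` vertices. -/
def IsProbDist {N : ℕ} (ρ : Fin N → ℝ) : Prop :=
  (∀ i, 0 < ρ i) ∧ ∑ i, ρ i = 1

/-- The Gibbs distribution `ρ*_i = e^{-Ψ_i/β} / Σ_j e^{-Ψ_j/β}`. -/
noncomputable def gibbs {N : ℕ} (Ψ : Fin N → ℝ) (β : ℝ) (i : Fin N) : ℝ :=
  Real.exp (-Ψ i / β) / ∑ j, Real.exp (-Ψ j / β)

/-- Right hand side of Fokker–Planck equation II (`Ψ̄_i = Ψ_i + β log ρ_i`). -/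
noncomputable def fpe2RHS {N : ℕ} (G : SimpleGraph (Fin N)) [DecidableRel G.Adj]
    (Ψ : Fin N → ℝ) (β : ℝ) (ρ : Fin N → ℝ) (i : Fin N) : ℝ :=
  (∑ j, if G.Adj i j ∧ Ψ i + β * Real.log (ρ i) < Ψ j + β * Real.log (ρ j) then
      ((Ψ j + β * Real.log (ρ j)) - (Ψ i + β * Real.log (ρ i))) * ρ j else 0)
  + (∑ j, if G.Adj i j ∧ Ψ j + β * Real.log (ρ j) < Ψ i + β * Real.log (ρ i) then
      ((Ψ j + β * Real.log (ρ j)) - (Ψ i + β * Real.log (ρ i))) * ρ i else 0)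

/-- `ρ : [0,∞) → M` is a solution of Fokker–Planck equation II. -/
def IsFPE2Sol {N : ℕ} (G : SimpleGraph (Fin N)) [DecidableRel G.Adj]
    (Ψ : Fin N → ℝ) (β : ℝ) (ρ : ℝ → Fin N → ℝ) : Prop :=
  (∀ t, 0 ≤ t → IsProbDist (ρ t)) ∧
  ∀ t, 0 ≤ t → ∀ i,
    HasDerivWithinAt (fun s => ρ s i) (fpe2RHS G Ψ β (ρ t) i) (Set.Ici 0) t

/-- Relative entropy `H(ν|μ) = Σ_i ν_i log (ν_i/μ_i)`. -/
noncomputable def relEnt {N : ℕ} (ν μ : Fin N → ℝ) : ℝ :=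
  ∑ i, ν i * Real.log (ν i / μ i)

/-- The entropy functional `Ent_μ(f)`. -/
noncomputable def entFunctional {N : ℕ} (μ f : Fin N → ℝ) : ℝ :=
  ∑ i, μ i * (f i * Real.log (f i)) - (∑ i, μ i * f i) * Real.log (∑ i, μ i * f i)

/-- The Dirichlet form `E(f, log f)` of a graph with respect to the measure `μ`. -/
noncomputable def dirichletForm {N : ℕ} (G : SimpleGraph (Fin N)) [DecidableRel G.Adj]
    (μ f : Fin N → ℝ) : ℝ :=
  ∑ i, ∑ j, if G.Adj i j then
    (Real.log (f i) - Real.log (f j)) * (f i - f j) * μ i else 0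

theorem gibbs_pos {N : ℕ} (Ψ : Fin N → ℝ) (β : ℝ) (i : Fin N) : 0 < gibbs Ψ β i :=
  div_pos (Real.exp_pos _) (Finset.sum_pos (fun _ _ => Real.exp_pos _) ⟨i, Finset.mem_univ i⟩)

/-- The potential `Ψ_i + β log ρ_i` is `β log (ρ_i / ρ*_i)` up to an additive constant. -/
theorem potential_add_log_eq {N : ℕ} (Ψ : Fin N → ℝ) {β : ℝ} (hβ : 0 < β) {ρ : Fin N → ℝ}
    (hρ : ∀ i, 0 < ρ i) (i : Fin N) :
    Ψ i + β * Real.log (ρ i) = β * Real.log (ρ i / gibbs Ψ β i)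
      - β * Real.log (∑ j, Real.exp (-Ψ j / β)) := by
  have hK : 0 < ∑ j, Real.exp (-Ψ j / β) :=
    Finset.sum_pos (fun _ _ => Real.exp_pos _) ⟨i, Finset.mem_univ i⟩
  rw [Real.log_div (hρ i).ne' (gibbs_pos Ψ β i).ne', gibbs,
    Real.log_div (Real.exp_pos _).ne' hK.ne', Real.log_exp]
  field_simp
  ring

theorem two_mul_sum_mul_sum_of_antisymm {ι : Type*} [Fintype ι] (L : ι → ℝ) (a : ι → ι → ℝ)
    (h : ∀ i j, a j i = -a i j) :
    2 * ∑ i, L i * ∑ j, a i j = ∑ i, ∑ j, (L i - L j) * a i j := by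
  have h1 : ∑ i, ∑ j, L j * a i j = -∑ i, ∑ j, L i * a i j := by
    rw [Finset.sum_comm, ← Finset.sum_neg_distrib]
    refine Finset.sum_congr rfl fun i _ => ?_
    rw [← Finset.sum_neg_distrib]
    refine Finset.sum_congr rfl fun j _ => ?_
    rw [h i j]
    ring
  simp only [sub_mul, Finset.sum_sub_distrib, h1, Finset.mul_sum]
  simp only [← Finset.mul_sum]
  ring

theorem sub_le_mul_log_sub_log {x y : ℝ} (hx : 0 < x) (hy : 0 < y) :
    x - y ≤ x * (Real.log x - Real.log y) := by
  have h := Real.log_le_sub_one_of_pos (div_pos hy hx)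
  rw [Real.log_div hy.ne' hx.ne'] at h
  have h2 := mul_le_mul_of_nonneg_left h hx.le
  have h3 : x * (y / x - 1) = y - x := by field_simp
  linarith

/-- The mass flux into vertex `i` from vertex `j` in Fokker–Planck equation II. -/
noncomputable def fpe2Flux {N : ℕ} (G : SimpleGraph (Fin N)) [DecidableRel G.Adj]
    (Ψ : Fin N → ℝ) (β : ℝ) (ρ : Fin N → ℝ) (i j : Fin N) : ℝ :=
  (if G.Adj i j ∧ Ψ i + β * Real.log (ρ i) < Ψ j + β * Real.log (ρ j) then
      ((Ψ j + β * Real.log (ρ j)) - (Ψ i + β * Real.log (ρ i))) * ρ j else 0)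
  + (if G.Adj i j ∧ Ψ j + β * Real.log (ρ j) < Ψ i + β * Real.log (ρ i) then
      ((Ψ j + β * Real.log (ρ j)) - (Ψ i + β * Real.log (ρ i))) * ρ i else 0)

theorem fpe2RHS_eq_sum_flux {N : ℕ} (G : SimpleGraph (Fin N)) [DecidableRel G.Adj]
    (Ψ : Fin N → ℝ) (β : ℝ) (ρ : Fin N → ℝ) (i : Fin N) :
    fpe2RHS G Ψ β ρ i = ∑ j, fpe2Flux G Ψ β ρ i j := by
  simp only [fpe2RHS, fpe2Flux, Finset.sum_add_distrib]

theorem fpe2Flux_antisymm {N : ℕ} (G : SimpleGraph (Fin N)) [DecidableRel G.Adj]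
    (Ψ : Fin N → ℝ) (β : ℝ) (ρ : Fin N → ℝ) (i j : Fin N) :
    fpe2Flux G Ψ β ρ j i = -fpe2Flux G Ψ β ρ i j := by
  simp only [fpe2Flux, G.adj_comm j i]
  split_ifs <;> ring

theorem sum_fpe2RHS {N : ℕ} (G : SimpleGraph (Fin N)) [DecidableRel G.Adj]
    (Ψ : Fin N → ℝ) (β : ℝ) (ρ : Fin N → ℝ) : ∑ i, fpe2RHS G Ψ β ρ i = 0 := by
  have h := two_mul_sum_mul_sum_of_antisymm (fun _ => (1 : ℝ)) (fpe2Flux G Ψ β ρ)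
    (fpe2Flux_antisymm G Ψ β ρ)
  simp only [one_mul, sub_self, zero_mul, Finset.sum_const_zero] at h
  simp only [fpe2RHS_eq_sum_flux]
  linarith

theorem log_sub_log_mul_fpe2Flux_le {N : ℕ} (G : SimpleGraph (Fin N)) [DecidableRel G.Adj]
    (Ψ : Fin N → ℝ) {β : ℝ} (hβ : 0 < β) {ρ f : Fin N → ℝ} (hρ : ∀ i, 0 < ρ i)
    (hf : ∀ i, f i = ρ i / gibbs Ψ β i) {m : ℝ} (hm0 : 0 ≤ m) (hm : ∀ i, m ≤ gibbs Ψ β i)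
    {i j : Fin N} (hij : G.Adj i j) :
    (Real.log (f i) - Real.log (f j)) * fpe2Flux G Ψ β ρ i j ≤
      -(β * m * ((Real.log (f i) - Real.log (f j)) * (f i - f j))) := by
  have hpos : ∀ k, 0 < f k := fun k => hf k ▸ div_pos (hρ k) (gibbs_pos Ψ β k)
  have hρf : ∀ k, m * f k ≤ ρ k := fun k => by
    have : ρ k = gibbs Ψ β k * f k := by
      rw [hf k, mul_div_cancel₀ _ (gibbs_pos Ψ β k).ne']
    rw [this]
    exact mul_le_mul_of_nonneg_right (hm k) (hpos k).le
  have key : ∀ k l, Real.log (f l) < Real.log (f k) →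
      m * ((Real.log (f k) - Real.log (f l)) * (f k - f l)) ≤
        (Real.log (f k) - Real.log (f l)) ^ 2 * ρ k := fun k l hkl => by
    have h1 := mul_le_mul_of_nonneg_left
      (sub_le_mul_log_sub_log (hpos k) (hpos l)) (mul_nonneg hm0 (sub_pos.2 hkl).le)
    have h2 := mul_le_mul_of_nonneg_left (hρf k)
      (sq_nonneg (Real.log (f k) - Real.log (f l)))
    linarith
  simp only [fpe2Flux, potential_add_log_eq Ψ hβ hρ, ← hf, hij, true_and, sub_lt_sub_iff_right,
    mul_lt_mul_iff_right₀ hβ]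
  rcases lt_trichotomy (Real.log (f i)) (Real.log (f j)) with h | h | h
  · rw [if_pos h, if_neg h.not_gt]
    linarith [mul_le_mul_of_nonneg_left (key j i h) hβ.le]
  · simp [h]
  · rw [if_neg h.not_gt, if_pos h]
    linarith [mul_le_mul_of_nonneg_left (key i j h) hβ.le]

/-- The entropy dissipation of Fokker–Planck equation II controls the Dirichlet form. -/
theorem two_mul_sum_log_mul_fpe2RHS_le {N : ℕ} (G : SimpleGraph (Fin N)) [DecidableRel G.Adj]
    (Ψ : Fin N → ℝ) {β : ℝ} (hβ : 0 < β) {ρ f : Fin N → ℝ} (hρ : ∀ i, 0 < ρ i)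
    (hf : ∀ i, f i = ρ i / gibbs Ψ β i) {m M : ℝ} (hm0 : 0 ≤ m) (hM0 : 0 < M)
    (hm : ∀ i, m ≤ gibbs Ψ β i) (hM : ∀ i, gibbs Ψ β i ≤ M) :
    2 * ∑ i, Real.log (f i) * fpe2RHS G Ψ β ρ i ≤
      -(β * (m / M) * dirichletForm G (gibbs Ψ β) f) := by
  have hpos : ∀ k, 0 < f k := fun k => hf k ▸ div_pos (hρ k) (gibbs_pos Ψ β k)
  simp only [fpe2RHS_eq_sum_flux]
  rw [two_mul_sum_mul_sum_of_antisymm _ _ (fpe2Flux_antisymm G Ψ β ρ), dirichletForm,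
    Finset.mul_sum, ← Finset.sum_neg_distrib]
  refine Finset.sum_le_sum fun i _ => ?_
  rw [Finset.mul_sum, ← Finset.sum_neg_distrib]
  refine Finset.sum_le_sum fun j _ => ?_
  by_cases hij : G.Adj i j
  · rw [if_pos hij]
    refine (log_sub_log_mul_fpe2Flux_le G Ψ hβ hρ hf hm0 hm hij).trans (neg_le_neg ?_)
    have hD : 0 ≤ (Real.log (f i) - Real.log (f j)) * (f i - f j) := by
      rcases le_total (f i) (f j) with h | h
      · exact mul_nonneg_of_nonpos_of_nonpos
          (sub_nonpos.2 (Real.log_le_log (hpos i) h)) (sub_nonpos.2 h)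
      · exact mul_nonneg (sub_nonneg.2 (Real.log_le_log (hpos j) h)) (sub_nonneg.2 h)
    have hw : m / M * gibbs Ψ β i ≤ m := by
      rw [div_mul_eq_mul_div, div_le_iff₀ hM0]
      exact mul_le_mul_of_nonneg_left (hM i) hm0
    linarith [mul_le_mul_of_nonneg_left hw (mul_nonneg hβ.le hD)]
  · simp [fpe2Flux, hij]

theorem entFunctional_div_eq_relEnt {N : ℕ} {μ ρ : Fin N → ℝ} (hμ : ∀ i, 0 < μ i)
    (hρ : ∑ i, ρ i = 1) : entFunctional μ (fun i => ρ i / μ i) = relEnt ρ μ := by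
  have h : ∀ i, μ i * (ρ i / μ i) = ρ i := fun i => mul_div_cancel₀ _ (hμ i).ne'
  simp only [entFunctional, relEnt, ← mul_assoc, h, hρ, Real.log_one, mul_zero, sub_zero]

theorem hasDerivWithinAt_relEnt {N : ℕ} {μ : Fin N → ℝ} (hμ : ∀ i, 0 < μ i)
    {ρ : ℝ → Fin N → ℝ} {v : Fin N → ℝ} {s : Set ℝ} {t : ℝ} (hpos : ∀ i, 0 < ρ t i)
    (hρ : ∀ i, HasDerivWithinAt (fun u => ρ u i) (v i) s t) :
    HasDerivWithinAt (fun u => relEnt (ρ u) μ)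
      (∑ i, Real.log (ρ t i / μ i) * v i + ∑ i, v i) s t := by
  unfold relEnt
  rw [← Finset.sum_add_distrib]
  refine HasDerivWithinAt.fun_sum fun i _ => ?_
  have hne : ρ t i / μ i ≠ 0 := (div_pos (hpos i) (hμ i)).ne'
  refine ((hρ i).fun_mul (((hρ i).div_const (μ i)).log hne)).congr_deriv ?_
  have h1 := (hpos i).ne'
  have h2 := (hμ i).ne'
  field_simp

/-- Grönwall's inequality for `h' ≤ -c h` on the half line. -/
theorem le_mul_exp_of_hasDerivWithinAt_le {h h' : ℝ → ℝ} {c : ℝ}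
    (hd : ∀ t, 0 ≤ t → HasDerivWithinAt h (h' t) (Set.Ici 0) t)
    (hle : ∀ t, 0 ≤ t → h' t ≤ -c * h t) {t : ℝ} (ht : 0 ≤ t) :
    h t ≤ h 0 * Real.exp (-c * t) := by
  have hexp : ∀ u : ℝ, HasDerivAt (fun s => Real.exp (c * s)) (Real.exp (c * u) * c) u :=
    fun u => by simpa using ((hasDerivAt_id u).const_mul c).exp
  have hF : ∀ u, 0 ≤ u → HasDerivWithinAt (fun s => h s * Real.exp (c * s))
      (h' u * Real.exp (c * u) + h u * (Real.exp (c * u) * c)) (Set.Ici 0) u :=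
    fun u hu => (hd u hu).mul (hexp u).hasDerivWithinAt
  have hanti : AntitoneOn (fun s => h s * Real.exp (c * s)) (Set.Ici 0) := by
    refine antitoneOn_of_hasDerivWithinAt_nonpos (convex_Ici 0)
      (fun u hu => (hF u hu).continuousWithinAt)
      (fun u hu => (hF u (interior_subset hu)).mono interior_subset) fun u hu => ?_
    have := mul_le_mul_of_nonneg_right (hle u (interior_subset hu)) (Real.exp_pos (c * u)).le
    linarith
  have := hanti (Set.mem_Ici.2 le_rfl) (Set.mem_Ici.2 ht) ht
  simp only [mul_zero, Real.exp_zero, mul_one] at this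
  rw [neg_mul, Real.exp_neg, ← div_eq_mul_inv, le_div_iff₀ (Real.exp_pos _)]
  exact this

theorem fpe2_entropy_decay {N : ℕ} (hN : 2 ≤ N)
    (G : SimpleGraph (Fin N)) [DecidableRel G.Adj] (hG : G.Connected)
    (Ψ : Fin N → ℝ) (β : ℝ) (hβ : 0 < β)
    (γ₀ : ℝ) (hγ₀ : 0 < γ₀)
    (hMLSI : ∀ f : Fin N → ℝ, (∀ i, 0 < f i) →
      2 * γ₀ * entFunctional (gibbs Ψ β) f ≤ dirichletForm G (gibbs Ψ β) f)
    (ρ : ℝ → Fin N → ℝ) (ρ0 : Fin N → ℝ) (hρ0 : IsProbDist ρ0)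
    (hsol : IsFPE2Sol G Ψ β ρ) (hinit : ρ 0 = ρ0) :
    ∀ t, 0 ≤ t →
      relEnt (ρ t) (gibbs Ψ β) ≤ relEnt ρ0 (gibbs Ψ β) *
        Real.exp (-(β * γ₀ * ((⨅ i, gibbs Ψ β i) / (⨆ i, gibbs Ψ β i))) * t) := by
  obtain ⟨hprob, hder⟩ := hsol
  subst hinit
  have hμ := gibbs_pos Ψ β
  have hm : ∀ i, ⨅ i, gibbs Ψ β i ≤ gibbs Ψ β i := ciInf_le (Set.finite_range _).bddBelow
  have hM : ∀ i, gibbs Ψ β i ≤ ⨆ i, gibbs Ψ β i := le_ciSup (Set.finite_range _).bddAbove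
  have hm0 : 0 ≤ ⨅ i, gibbs Ψ β i := Real.iInf_nonneg fun i => (hμ i).le
  have hM0 : 0 < ⨆ i, gibbs Ψ β i := (hμ ⟨0, by omega⟩).trans_le (hM _)
  intro t ht
  refine le_mul_exp_of_hasDerivWithinAt_le (h := fun u => relEnt (ρ u) (gibbs Ψ β))
    (fun u hu => hasDerivWithinAt_relEnt hμ (hprob u hu).1 (hder u hu)) (fun u hu => ?_) ht
  obtain ⟨hρ, hsum⟩ := hprob u hu
  have hdiss := two_mul_sum_log_mul_fpe2RHS_le G Ψ hβ hρ (fun i => rfl) hm0 hM0 hm hM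
  have hE := hMLSI (fun i => ρ u i / gibbs Ψ β i) fun i => div_pos (hρ i) (hμ i)
  rw [entFunctional_div_eq_relEnt hμ hsum] at hE
  rw [sum_fpe2RHS, add_zero]
  have := mul_le_mul_of_nonneg_left hE (mul_nonneg hβ.le (div_nonneg hm0 hM0.le))
  linarith
end

section
/- Let G = (V,E) be a connected simple graph on N ≥ 2 vertices with maximal degree D and spectral gap λ₂, and let μ ∈ M. Set m = min_i μ_i and M₁ = max_i μ_i. Then for every ν ∈ M: d_m²(ν, μ) ≤ K · H(ν|μ), where K = (M₁(DN³ + 4)/(2λ₂ m)) · log(18M₁/m³). -/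
/-!
STATEMENT 6: Global Talagrand-type inequality for the lower bound metric d_m:
d_m²(ν,μ) ≤ K H(ν|μ) with K = (M₁(DN³+4)/(2λ₂ m)) log(18M₁/m³).
-/

open Finset Real Matrix Classical

/-- Weighted Laplacian `L(G,w) = diag(row sums) − w` (the graph structure is
encoded in the vanishing pattern of `w`). -/
noncomputable def wLap {N : ℕ} (w : Matrix (Fin N) (Fin N) ℝ) :
    Matrix (Fin N) (Fin N) ℝ :=
  Matrix.diagonal (fun i => ∑ j, w i j) - w

/-- The quadratic form `g(σ,σ) = p L pᵀ`, where `p` is a row vector with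
`σ = p L`; since `p L pᵀ = p ⬝ᵥ σ` this value does not depend on the choice
of `p` when `σ` is in the range of `L` and sums to zero. -/
noncomputable def quadForm {N : ℕ} (L : Matrix (Fin N) (Fin N) ℝ)
    (σ : Fin N → ℝ) : ℝ :=
  if h : ∃ p, Matrix.vecMul p L = σ then Classical.choose h ⬝ᵥ σ else 0

/-- The "lower bound" weight matrix `w^m(ρ)`: `w^m_{ij} = max(ρ_i,ρ_j)` on
edges and `0` otherwise. -/
noncomputable def weightM {N : ℕ} (G : SimpleGraph (Fin N)) [DecidableRel G.Adj]
    (ρ : Fin N → ℝ) : Matrix (Fin N) (Fin N) ℝ :=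
  Matrix.of fun i j => if G.Adj i j then max (ρ i) (ρ j) else 0

/-- The set of arc lengths of C¹ curves in `M` joining `ρ1` to `ρ2`, for the
Riemannian structure with weight matrix `gmat ρ` at `ρ`. -/
noncomputable def arcLengthSet {N : ℕ}
    (gmat : (Fin N → ℝ) → Matrix (Fin N) (Fin N) ℝ)
    (ρ1 ρ2 : Fin N → ℝ) : Set ℝ :=
  { l | ∃ γ : ℝ → Fin N → ℝ, ContDiffOn ℝ 1 γ (Set.Icc 0 1) ∧
      (∀ t ∈ Set.Icc (0 : ℝ) 1, IsProbDist (γ t)) ∧ γ 0 = ρ1 ∧ γ 1 = ρ2 ∧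
      l = ∫ t in (0 : ℝ)..1,
            Real.sqrt (quadForm (wLap (gmat (γ t))) (deriv γ t)) }

/-- The lower bound metric `d_m` on `M`. -/
noncomputable def dLower {N : ℕ} (G : SimpleGraph (Fin N)) [DecidableRel G.Adj]
    (ρ1 ρ2 : Fin N → ℝ) : ℝ :=
  sInf (arcLengthSet (weightM G) ρ1 ρ2)

/-- The eigenvalues of a real symmetric matrix, sorted in nondecreasing order
(with multiplicity).  For a non-Hermitian matrix this returns the junk value `0`. -/
noncomputable def sortedEigs {N : ℕ} (A : Matrix (Fin N) (Fin N) ℝ) : Fin N → ℝ :=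
  if h : A.IsHermitian then h.eigenvalues ∘ Tuple.sort h.eigenvalues else 0

lemma IsProbDist.le_one {N : ℕ} {ρ : Fin N → ℝ} (h : IsProbDist ρ) (i : Fin N) : ρ i ≤ 1 :=
  h.2 ▸ Finset.single_le_sum (fun j _ => (h.1 j).le) (Finset.mem_univ i)

/-- A one-point quadratic lower bound for the relative entropy integrand. -/
lemma sq_sub_div_two_le_mul_log_div {x y : ℝ} (hx : 0 < x) (hy : 0 < y) (hx1 : x ≤ 1)
    (hy1 : y ≤ 1) : (x - y) ^ 2 / 2 + (x - y) ≤ x * Real.log (x / y) := by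
  rcases le_total y x with h | h
  · have key := Real.le_log_one_add_of_nonneg (x := (x - y) / y) (by
      apply div_nonneg <;> linarith)
    have e1 : 1 + (x - y) / y = x / y := by field_simp; ring
    have e2 : 2 * ((x - y) / y) / ((x - y) / y + 2) = 2 * (x - y) / (x + y) := by
      have : (x - y) / y + 2 = (x + y) / y := by field_simp; ring
      rw [this]; field_simp
    rw [e1, e2] at key
    have h3 : (x - y) ^ 2 / 2 ≤ (x - y) ^ 2 / (x + y) := by
      gcongr; linarith
    have h4 : x * (2 * (x - y) / (x + y)) = (x - y) ^ 2 / (x + y) + (x - y) := by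
      field_simp; ring
    nlinarith [mul_le_mul_of_nonneg_left key hx.le]
  · have h1 : 1 ≤ y / x := by rw [one_le_div hx]; exact h
    have key := Real.self_le_sinh_iff.2 (Real.log_nonneg h1)
    rw [Real.sinh_log (by positivity), Real.log_div hy.ne' hx.ne'] at key
    rw [Real.log_div hx.ne' hy.ne']
    have h3 : (x - y) ^ 2 / 2 ≤ (x - y) ^ 2 / (2 * y) := by
      gcongr; linarith
    have h4 : x * ((y / x - (y / x)⁻¹) / 2) = -((x - y) ^ 2 / (2 * y) + (x - y)) := by
      field_simp; ring
    nlinarith [mul_le_mul_of_nonneg_left key hx.le]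

lemma sum_sq_sub_le_two_mul_relEnt {N : ℕ} {ν μ : Fin N → ℝ} (hν : IsProbDist ν)
    (hμ : IsProbDist μ) : ∑ i, (ν i - μ i) ^ 2 ≤ 2 * relEnt ν μ := by
  have h : ∑ i, ((ν i - μ i) ^ 2 / 2 + (ν i - μ i)) ≤ relEnt ν μ :=
    Finset.sum_le_sum fun i _ =>
      sq_sub_div_two_le_mul_log_div (hν.1 i) (hμ.1 i) (hν.le_one i) (hμ.le_one i)
  rw [Finset.sum_add_distrib, Finset.sum_sub_distrib, hν.2, hμ.2, ← Finset.sum_div] at h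
  linarith

/-- The Dirichlet form of a weighted Laplacian. -/
lemma vecMul_wLap_dotProduct {N : ℕ} {w : Matrix (Fin N) (Fin N) ℝ}
    (hw : ∀ i j, w i j = w j i) (p : Fin N → ℝ) :
    (p ᵥ* wLap w) ⬝ᵥ p = (∑ i, ∑ j, w i j * (p i - p j) ^ 2) / 2 := by
  have h1 : (p ᵥ* wLap w) ⬝ᵥ p = ∑ i, ∑ j, w i j * p i ^ 2 - ∑ i, ∑ j, w i j * (p i * p j) := by
    rw [← Matrix.dotProduct_mulVec, wLap, Matrix.sub_mulVec, dotProduct_sub]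
    simp only [dotProduct, Matrix.mulVec_diagonal]
    congr 1
    · refine Finset.sum_congr rfl fun i _ => ?_
      rw [Finset.sum_mul, Finset.mul_sum]
      exact Finset.sum_congr rfl fun j _ => by ring
    · refine Finset.sum_congr rfl fun i _ => ?_
      rw [Matrix.mulVec, dotProduct, Finset.mul_sum]
      exact Finset.sum_congr rfl fun j _ => by ring
  have h2 : ∑ i, ∑ j, w i j * p j ^ 2 = ∑ i, ∑ j, w i j * p i ^ 2 := by
    rw [Finset.sum_comm]
    exact Finset.sum_congr rfl fun i _ => Finset.sum_congr rfl fun j _ => by rw [hw j i]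
  have h3 : ∑ i, ∑ j, w i j * (p i - p j) ^ 2 = ∑ i, ∑ j, w i j * p i ^ 2
      + ∑ i, ∑ j, w i j * p j ^ 2 - 2 * ∑ i, ∑ j, w i j * (p i * p j) := by
    simp only [Finset.mul_sum, ← Finset.sum_add_distrib, ← Finset.sum_sub_distrib]
    exact Finset.sum_congr rfl fun i _ => Finset.sum_congr rfl fun j _ => by ring
  rw [h1, h3, h2]; ring

lemma Matrix.IsHermitian.sum_dotProduct_eigenvectorBasis {N : ℕ}
    {A : Matrix (Fin N) (Fin N) ℝ} (hA : A.IsHermitian) (x y : Fin N → ℝ) :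
    ∑ i, (x ⬝ᵥ ⇑(hA.eigenvectorBasis i)) * (⇑(hA.eigenvectorBasis i) ⬝ᵥ y) = x ⬝ᵥ y := by
  have h := hA.eigenvectorBasis.sum_inner_mul_inner (WithLp.toLp 2 x) (WithLp.toLp 2 y)
  simpa [EuclideanSpace.inner_eq_star_dotProduct, dotProduct_comm] using h

lemma Matrix.IsHermitian.dotProduct_mulVec_eq_sum_eigenvalues {N : ℕ}
    {A : Matrix (Fin N) (Fin N) ℝ} (hA : A.IsHermitian) (x : Fin N → ℝ) :
    x ⬝ᵥ (A *ᵥ x) =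
      ∑ i, hA.eigenvalues i * (x ⬝ᵥ ⇑(hA.eigenvectorBasis i)) ^ 2 := by
  rw [← hA.sum_dotProduct_eigenvectorBasis x (A *ᵥ x)]
  refine Finset.sum_congr rfl fun i _ => ?_
  have hT : Aᵀ = A := by simpa [Matrix.IsHermitian] using hA
  rw [Matrix.dotProduct_mulVec, ← Matrix.mulVec_transpose, hT, hA.mulVec_eigenvectorBasis,
    smul_dotProduct, smul_eq_mul, dotProduct_comm _ x]
  ring

section SpectralGap

variable {N : ℕ} (hN : 2 ≤ N)

/-- The eigenvectors of the Laplacian of a connected graph for the eigenvalue `0` are constant. -/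
lemma SimpleGraph.Connected.eigenvectorBasis_lapMatrix_const {G : SimpleGraph (Fin N)}
    [DecidableRel G.Adj] (hG : G.Connected) {i : Fin N}
    (hi : (G.isHermitian_lapMatrix ℝ).eigenvalues i = 0) (a b : Fin N) :
    (G.isHermitian_lapMatrix ℝ).eigenvectorBasis i a =
      (G.isHermitian_lapMatrix ℝ).eigenvectorBasis i b := by
  have h := (G.isHermitian_lapMatrix ℝ).mulVec_eigenvectorBasis i
  rw [hi, zero_smul] at h
  exact G.lapMatrix_mulVec_eq_zero_iff_forall_reachable.1 h a b (hG.preconnected a b)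

lemma SimpleGraph.Connected.eigenvalues_lapMatrix_sort_zero {G : SimpleGraph (Fin N)}
    [DecidableRel G.Adj] (hG : G.Connected) (h0 : 0 < N) :
    (G.isHermitian_lapMatrix ℝ).eigenvalues
      (Tuple.sort (G.isHermitian_lapMatrix ℝ).eigenvalues ⟨0, h0⟩) = 0 := by
  set hA := G.isHermitian_lapMatrix ℝ
  have : Nonempty (Fin N) := hG.nonempty
  have hdet := G.det_lapMatrix_eq_zero
  rw [hA.det_eq_prod_eigenvalues] at hdet
  obtain ⟨i, -, hi⟩ := Finset.prod_eq_zero_iff.1 hdet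
  have hi : hA.eigenvalues i = 0 := by simpa using hi
  refine le_antisymm ?_ ((G.posSemidef_lapMatrix ℝ).eigenvalues_nonneg _)
  have hm := Tuple.monotone_sort hA.eigenvalues
    (show (⟨0, h0⟩ : Fin N) ≤ (Tuple.sort hA.eigenvalues).symm i from Nat.zero_le _)
  simpa [hi] using hm

lemma sortedEigs_lapMatrix_pos {G : SimpleGraph (Fin N)} [DecidableRel G.Adj]
    (hG : G.Connected) : 0 < sortedEigs (G.lapMatrix ℝ) ⟨1, hN⟩ := by
  have hA := G.isHermitian_lapMatrix ℝ
  rw [sortedEigs, dif_pos hA, Function.comp_apply]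
  refine lt_of_le_of_ne ((G.posSemidef_lapMatrix ℝ).eigenvalues_nonneg _) fun h => ?_
  set i := Tuple.sort hA.eigenvalues ⟨0, by omega⟩ with hi
  set j := Tuple.sort hA.eigenvalues ⟨1, hN⟩ with hj
  have hij : i ≠ j := by simp [hi, hj]
  have hic := hG.eigenvectorBasis_lapMatrix_const (hG.eigenvalues_lapMatrix_sort_zero (by omega))
  have hjc := hG.eigenvectorBasis_lapMatrix_const h.symm
  let v : Fin N := ⟨0, by omega⟩
  have ho : inner ℝ (hA.eigenvectorBasis i) (hA.eigenvectorBasis j) = 0 :=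
    hA.eigenvectorBasis.orthonormal.2 hij
  have hni := hA.eigenvectorBasis.orthonormal.1 i
  have hnj := hA.eigenvectorBasis.orthonormal.1 j
  have e : ∀ {k : Fin N}, (∀ a b, hA.eigenvectorBasis k a = hA.eigenvectorBasis k b) →
      ‖hA.eigenvectorBasis k‖ = 1 → hA.eigenvectorBasis k v ≠ 0 := by
    intro k hk hn h0
    have : hA.eigenvectorBasis k = 0 := by
      ext a
      rw [hk a v, h0]; rfl
    simp [this] at hn
  rw [EuclideanSpace.inner_eq_star_dotProduct] at ho
  simp only [star_trivial, dotProduct] at ho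
  rw [Finset.sum_congr rfl fun a _ => by rw [hjc a v, hic a v]] at ho
  simp only [Finset.sum_const, Finset.card_univ, Fintype.card_fin, nsmul_eq_mul] at ho
  have hN0 : (N : ℝ) ≠ 0 := by positivity
  exact mul_ne_zero hN0 (mul_ne_zero (e hjc hnj) (e hic hni)) ho

/-- The Poincaré inequality for the second eigenvalue of the graph Laplacian. -/
lemma sortedEigs_mul_dotProduct_self_le {G : SimpleGraph (Fin N)} [DecidableRel G.Adj]
    (hG : G.Connected) {q : Fin N → ℝ} (hq : ∑ i, q i = 0) :
    sortedEigs (G.lapMatrix ℝ) ⟨1, hN⟩ * ∑ i, q i ^ 2 ≤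
      (∑ i, ∑ j, if G.Adj i j then (q i - q j) ^ 2 else 0) / 2 := by
  have hA := G.isHermitian_lapMatrix ℝ
  rw [← G.lapMatrix_toLinearMap₂' ℝ q, Matrix.toLinearMap₂'_apply',
    hA.dotProduct_mulVec_eq_sum_eigenvalues]
  have hs : ∑ i, q i ^ 2 = ∑ i, (q ⬝ᵥ ⇑(hA.eigenvectorBasis i)) ^ 2 := by
    have h := hA.sum_dotProduct_eigenvectorBasis q q
    simp only [dotProduct_comm _ q] at h
    simpa [dotProduct, pow_two] using h.symm
  rw [hs, Finset.mul_sum]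
  refine Finset.sum_le_sum fun i _ => ?_
  rw [sortedEigs, dif_pos hA, Function.comp_apply]
  by_cases hi : i = Tuple.sort hA.eigenvalues ⟨0, by omega⟩
  · have hic := hG.eigenvectorBasis_lapMatrix_const
      (hG.eigenvalues_lapMatrix_sort_zero (by omega))
    rw [← hi] at hic
    have hz : q ⬝ᵥ ⇑(hA.eigenvectorBasis i) = 0 := by
      rw [dotProduct, Finset.sum_congr rfl fun a _ => by rw [hic a i], ← Finset.sum_mul, hq,
        zero_mul]
    simp [hz]
  · gcongr
    have hle : (⟨1, hN⟩ : Fin N) ≤ (Tuple.sort hA.eigenvalues).symm i := by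
      rw [Fin.le_def]
      refine Nat.one_le_iff_ne_zero.2 fun h => hi ?_
      rw [← Equiv.symm_apply_eq]
      exact Fin.ext h
    simpa using Tuple.monotone_sort hA.eigenvalues hle

/-- If all edge weights are at least `c`, the metric is controlled by the Euclidean one. -/
lemma quadForm_weightM_le {G : SimpleGraph (Fin N)} [DecidableRel G.Adj] (hG : G.Connected)
    {ρ σ : Fin N → ℝ} {c : ℝ} (hc : 0 < c) (hρ : ∀ i, c ≤ ρ i) (hσ : ∑ i, σ i = 0) :
    quadForm (wLap (weightM G ρ)) σ ≤
      (∑ i, σ i ^ 2) / (c * sortedEigs (G.lapMatrix ℝ) ⟨1, hN⟩) := by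
  have hl := sortedEigs_lapMatrix_pos hN hG
  have hS : 0 ≤ ∑ i, σ i ^ 2 := Finset.sum_nonneg fun i _ => sq_nonneg _
  set l := sortedEigs (G.lapMatrix ℝ) ⟨1, hN⟩
  rw [quadForm]
  split_ifs with h
  swap
  · positivity
  have hp := Classical.choose_spec h
  set p := Classical.choose h
  have hN0 : (N : ℝ) ≠ 0 := by
    have : 0 < N := by omega
    positivity
  let q : Fin N → ℝ := fun i => p i - (∑ j, p j) / N
  have hq : ∑ i, q i = 0 := by
    simp only [q, Finset.sum_sub_distrib, Finset.sum_const, Finset.card_univ, Fintype.card_fin,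
      nsmul_eq_mul]
    field_simp
    ring
  have hqσ : ∑ i, q i * σ i = p ⬝ᵥ σ := by
    simp only [q, sub_mul, Finset.sum_sub_distrib, ← Finset.mul_sum, hσ, dotProduct]
    ring
  have henergy : p ⬝ᵥ σ = (∑ i, ∑ j, weightM G ρ i j * (p i - p j) ^ 2) / 2 := by
    rw [← vecMul_wLap_dotProduct, hp, dotProduct_comm]
    intro i j
    simp [weightM, G.adj_comm i j, max_comm]
  have hlow : c * (l * ∑ i, q i ^ 2) ≤ p ⬝ᵥ σ := by
    refine (mul_le_mul_of_nonneg_left (sortedEigs_mul_dotProduct_self_le hN hG hq) hc.le).trans ?_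
    rw [henergy, ← mul_div_assoc]
    gcongr
    simp only [Finset.mul_sum]
    refine Finset.sum_le_sum fun i _ => Finset.sum_le_sum fun j _ => ?_
    simp only [weightM, Matrix.of_apply]
    split_ifs
    · simp only [q, sub_sub_sub_cancel_right]
      gcongr
      exact (hρ i).trans (le_max_left _ _)
    · simp
  have hcs : (p ⬝ᵥ σ) ^ 2 ≤ (∑ i, q i ^ 2) * ∑ i, σ i ^ 2 := by
    rw [← hqσ]; exact Finset.sum_mul_sq_le_sq_mul_sq _ _ _
  have hcl : 0 < c * l := by positivity
  rw [le_div_iff₀ hcl]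
  by_contra! hlt
  have hA : 0 < p ⬝ᵥ σ := by
    by_contra! hA
    nlinarith
  nlinarith [mul_le_mul_of_nonneg_right hlow hS, mul_lt_mul_of_pos_right hlt hA]

end SpectralGap

/-- Comparison of `d_m` with the Euclidean distance, along the segment from `ν` to `μ`. -/
lemma dLower_sq_le {N : ℕ} (hN : 2 ≤ N) {G : SimpleGraph (Fin N)} [DecidableRel G.Adj]
    (hG : G.Connected) {μ ν : Fin N → ℝ} (hμ : IsProbDist μ) (hν : IsProbDist ν) {m : ℝ}
    (hm : 0 < m) (hmμ : ∀ i, m ≤ μ i) :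
    dLower G ν μ ^ 2 ≤
      4 * (∑ i, (ν i - μ i) ^ 2) / (m * sortedEigs (G.lapMatrix ℝ) ⟨1, hN⟩) := by
  have hl := sortedEigs_lapMatrix_pos hN hG
  set l := sortedEigs (G.lapMatrix ℝ) ⟨1, hN⟩
  set S := ∑ i, (ν i - μ i) ^ 2 with hSdef
  have hS : 0 ≤ S := Finset.sum_nonneg fun i _ => sq_nonneg _
  have hnn : ∀ x ∈ arcLengthSet (weightM G) ν μ, 0 ≤ x := by
    rintro _ ⟨γ, -, -, -, -, rfl⟩
    exact intervalIntegral.integral_nonneg zero_le_one fun t _ => Real.sqrt_nonneg _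
  let γ : ℝ → Fin N → ℝ := fun t => ν + t • (μ - ν)
  have hder : ∀ t, HasDerivAt γ (μ - ν) t := fun t => by
    simpa only [one_smul] using! ((hasDerivAt_id t).smul_const (μ - ν)).const_add ν
  have hmem : ∫ t in (0 : ℝ)..1, Real.sqrt (quadForm (wLap (weightM G (γ t))) (deriv γ t)) ∈
      arcLengthSet (weightM G) ν μ := by
    refine ⟨γ, ?_, fun t ht => ⟨fun i => ?_, ?_⟩, by simp [γ], by simp [γ], rfl⟩
    · exact (contDiff_const.add (contDiff_id.smul contDiff_const)).contDiffOn
    · have h1 := hν.1 i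
      have h2 := hμ.1 i
      simp only [γ, Pi.add_apply, Pi.smul_apply, Pi.sub_apply, smul_eq_mul]
      rcases ht.1.eq_or_lt with h | h
      · rw [← h]; linarith
      · nlinarith [mul_pos h h2, mul_nonneg (sub_nonneg.2 ht.2) h1.le]
    · simp [γ, Finset.sum_add_distrib, ← Finset.mul_sum, hν.2, hμ.2]
  have hint : ∫ t in (0 : ℝ)..1, Real.sqrt (quadForm (wLap (weightM G (γ t))) (deriv γ t)) ≤
      2 * Real.sqrt (S / (m * l)) := by
    have hI : ∫ t in (0 : ℝ)..1, Real.sqrt (S / (m * l)) * t ^ (-(1 / 2) : ℝ) =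
        2 * Real.sqrt (S / (m * l)) := by
      rw [intervalIntegral.integral_const_mul, integral_rpow (Or.inl (by norm_num))]
      norm_num
      ring
    rw [← hI]
    refine (Real.le_norm_self _).trans
      (intervalIntegral.norm_integral_le_of_norm_le zero_le_one ?_ ?_)
    · refine Filter.Eventually.of_forall fun t ht => ?_
      rw [Real.norm_of_nonneg (Real.sqrt_nonneg _), (hder t).deriv, Real.rpow_neg ht.1.le,
        ← Real.sqrt_eq_rpow, ← div_eq_mul_inv, ← Real.sqrt_div (by positivity)]
      refine Real.sqrt_le_sqrt ?_
      have hσ : ∑ i, (μ - ν) i = 0 := by simp [hν.2, hμ.2]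
      have hlow : ∀ i, t * m ≤ γ t i := fun i => by
        simp only [γ, Pi.add_apply, Pi.smul_apply, Pi.sub_apply, smul_eq_mul]
        nlinarith [mul_le_mul_of_nonneg_left (hmμ i) ht.1.le,
          mul_nonneg (sub_nonneg.2 ht.2) (hν.1 i).le]
      refine (quadForm_weightM_le hN hG (mul_pos ht.1 hm) hlow hσ).trans_eq ?_
      have hSe : ∑ i, (μ - ν) i ^ 2 = S :=
        Finset.sum_congr rfl fun i _ => by simp only [Pi.sub_apply]; ring
      rw [hSe, div_div]
      congr 1
      ring
    · exact (intervalIntegral.intervalIntegrable_rpow' (by norm_num)).const_mul _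
  have hd : dLower G ν μ ≤ 2 * Real.sqrt (S / (m * l)) := (csInf_le ⟨0, hnn⟩ hmem).trans hint
  have hd0 : 0 ≤ dLower G ν μ := Real.sInf_nonneg hnn
  calc dLower G ν μ ^ 2 ≤ (2 * Real.sqrt (S / (m * l))) ^ 2 := by gcongr
    _ = 4 * S / (m * l) := by
      rw [mul_pow, Real.sq_sqrt (by positivity)]; ring

theorem global_talagrand_dLower {N : ℕ} (hN : 2 ≤ N)
    (G : SimpleGraph (Fin N)) [DecidableRel G.Adj] (hG : G.Connected)
    (μ : Fin N → ℝ) (hμ : IsProbDist μ)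
    (ν : Fin N → ℝ) (hν : IsProbDist ν) :
    dLower G ν μ ^ 2 ≤
      ((⨆ i, μ i) * (((Finset.univ.sup fun i => G.degree i : ℕ) : ℝ) * (N : ℝ) ^ 3 + 4) /
          (2 * sortedEigs (G.lapMatrix ℝ) ⟨1, by omega⟩ * ⨅ i, μ i)) *
        Real.log (18 * (⨆ i, μ i) / (⨅ i, μ i) ^ 3) * relEnt ν μ := by
  have : Nontrivial (Fin N) := Fin.nontrivial_iff_two_le.2 hN
  have hl := sortedEigs_lapMatrix_pos hN hG
  set l := sortedEigs (G.lapMatrix ℝ) ⟨1, by omega⟩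
  have hmi : ∀ i, ⨅ i, μ i ≤ μ i := ciInf_le (Set.finite_range μ).bddBelow
  have hMi : ∀ i, μ i ≤ ⨆ i, μ i := le_ciSup (Set.finite_range μ).bddAbove
  obtain ⟨i₀, hi₀⟩ := exists_eq_ciInf_of_finite (f := μ)
  have hm : 0 < ⨅ i, μ i := hi₀ ▸ hμ.1 i₀
  have hd := dLower_sq_le hN hG hμ hν hm hmi
  have hH := sum_sq_sub_le_two_mul_relEnt hν hμ
  set m := ⨅ i, μ i
  set M := ⨆ i, μ i
  have hNm : (N : ℝ) * m ≤ 1 := by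
    rw [← hμ.2]
    simpa using Finset.card_nsmul_le_sum Finset.univ μ m fun i _ => hmi i
  have hNM : 1 ≤ (N : ℝ) * M := by
    rw [← hμ.2]
    simpa using Finset.sum_le_card_nsmul Finset.univ μ M fun i _ => hMi i
  have hN2 : (2 : ℝ) ≤ N := by exact_mod_cast hN
  have hm2 : m ≤ 1 / 2 := by nlinarith
  have hmM : m ≤ M := (hmi i₀).trans (hMi i₀)
  have hD : (1 : ℝ) ≤ ((Finset.univ.sup fun i => G.degree i : ℕ) : ℝ) := by
    have h1 : 0 < G.degree i₀ := hG.preconnected.degree_pos_of_nontrivial i₀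
    have h2 : G.degree i₀ ≤ Finset.univ.sup fun i => G.degree i :=
      Finset.le_sup (f := fun i => G.degree i) (Finset.mem_univ i₀)
    exact_mod_cast h1.trans_le h2
  set D := ((Finset.univ.sup fun i => G.degree i : ℕ) : ℝ)
  have hlog : 4 ≤ Real.log (18 * M / m ^ 3) := by
    have h1 : (72 : ℝ) ≤ 18 * M / m ^ 3 := by
      rw [le_div_iff₀ (by positivity)]
      nlinarith [mul_pos hm hm, mul_nonneg hm.le (sub_nonneg.2 hm2),
        mul_le_mul_of_nonneg_left (show m ^ 2 ≤ 1 / 4 by nlinarith) hm.le]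
    rw [Real.le_log_iff_exp_le (by linarith)]
    refine le_trans ?_ h1
    have h2 : Real.exp 4 = Real.exp 1 ^ 4 := by rw [← Real.exp_nat_mul]; norm_num
    rw [h2]
    calc Real.exp 1 ^ 4 ≤ 2.7182818286 ^ 4 := by gcongr; exact Real.exp_one_lt_d9.le
      _ ≤ 72 := by norm_num
  have hpre : 4 ≤ M * (D * (N : ℝ) ^ 3 + 4) := by
    have hM : 0 < M := hm.trans_le hmM
    calc (4 : ℝ) ≤ (N * M) * (N : ℝ) ^ 2 := by nlinarith
      _ = M * (1 * (N : ℝ) ^ 3) := by ring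
      _ ≤ M * (D * (N : ℝ) ^ 3 + 4) := by
        gcongr
        have : 1 * (N : ℝ) ^ 3 ≤ D * (N : ℝ) ^ 3 := by gcongr
        linarith
  have hH0 : 0 ≤ relEnt ν μ := by
    have : 0 ≤ ∑ i, (ν i - μ i) ^ 2 := Finset.sum_nonneg fun i _ => sq_nonneg _
    linarith
  calc dLower G ν μ ^ 2 ≤ 4 * (∑ i, (ν i - μ i) ^ 2) / (m * l) := hd
    _ ≤ 4 * (2 * relEnt ν μ) / (m * l) := by gcongr
    _ = 4 / (2 * l * m) * 4 * relEnt ν μ := by field_simp; ring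
    _ ≤ M * (D * (N : ℝ) ^ 3 + 4) / (2 * l * m) * Real.log (18 * M / m ^ 3) * relEnt ν μ := by
      gcongr
end
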